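/- arXiv:math/0405136 — 2 statements merged into one kernel-verified Lean document; each statement's English description precedes it below -/
import Mathlib

section
/- Let 1 ≤ m ≤ k and n ≥ 0. For any partition μ: μ ≼ (m^n) in the k-Young order if and only if μ ⊆ (m^n) (i.e., μ₁ ≤ m and ℓ(μ) ≤ n) and μ has at most k−m+1 parts strictly smaller than m. -/
/-- A partition: a weakly decreasing list of positive integers. -/
def IsPartition (l : List ℕ) : Prop :=
  l.Pairwise (· ≥ ·) ∧ ∀ x ∈ l, 0 < x

/-- The `i`-th part (0-indexed), with parts beyond the length equal to 0. -/
def part (l : List ℕ) (i : ℕ) : ℕ := l.getD i 0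

/-- Diagram containment `l ⊆ m`: every part of `l` is at most the corresponding part of `m`. -/
def SubDiag (l m : List ℕ) : Prop := ∀ i, part l i ≤ part m i

/-- A `k`-bounded partition: a partition whose first part is at most `k`. -/
def KBounded (k : ℕ) (l : List ℕ) : Prop := IsPartition l ∧ part l 0 ≤ k

/-- Hook length of the square `(i,j)` (0-indexed) with respect to the skew diagram
`outer/inner`: the number of cells `(i,j')` of the skew diagram with `j' ≥ j` plus the
number of cells `(i',j)` of the skew diagram with `i' > i`. -/
def hookLen (outer inner : List ℕ) (i j : ℕ) : ℕ :=
  ((Finset.range (part outer i)).filter (fun j' => j ≤ j' ∧ part inner i ≤ j')).card +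
  ((Finset.range outer.length).filter
    (fun i' => i < i' ∧ part inner i' ≤ j ∧ j < part outer i')).card

/-- `(outer, inner)` is the `k`-skew diagram of the `k`-bounded partition `l`:
row `i` of `outer/inner` has `l i` cells, every cell of `outer/inner` has hook length
at most `k`, and every square of the inner shape has hook length exceeding `k`. -/
def IsKSkew (k : ℕ) (l outer inner : List ℕ) : Prop :=
  IsPartition outer ∧ IsPartition inner ∧ SubDiag inner outer ∧
  (∀ i, part outer i - part inner i = part l i) ∧
  (∀ i j, part inner i ≤ j → j < part outer i → hookLen outer inner i j ≤ k) ∧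
  (∀ i j, j < part inner i → k < hookLen outer inner i j)

/-- Length of column `j` of the skew diagram `outer/inner`. -/
def colLen (outer inner : List ℕ) (j : ℕ) : ℕ :=
  ((Finset.range outer.length).filter
    (fun i => part inner i ≤ j ∧ j < part outer i)).card

/-- The list of column lengths of the skew diagram `outer/inner`. -/
def skewCols (outer inner : List ℕ) : List ℕ :=
  ((List.range (part outer 0)).map (colLen outer inner)).filter (fun x => decide (x ≠ 0))

/-- The `k`-conjugate of `l`: the partition whose parts are the column lengths of the
(unique) `k`-skew diagram of `l`. -/
noncomputable def kConj (k : ℕ) (l : List ℕ) : List ℕ :=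
  haveI := Classical.dec (∃ p : List ℕ × List ℕ, IsKSkew k l p.1 p.2)
  if h : ∃ p : List ℕ × List ℕ, IsKSkew k l p.1 p.2 then
    skewCols h.choose.1 h.choose.2
  else []

/-- The covering relation of the `k`-Young order on `k`-bounded partitions. -/
def KCover (k : ℕ) (l m : List ℕ) : Prop :=
  KBounded k l ∧ KBounded k m ∧ SubDiag l m ∧
  SubDiag (kConj k l) (kConj k m) ∧ m.sum = l.sum + 1

/-- The `k`-Young order: reflexive-transitive closure of the covering relation. -/
def KLe (k : ℕ) : List ℕ → List ℕ → Prop := Relation.ReflTransGen (KCover k)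

/-- The weakly decreasing rearrangement of the combined parts of two partitions. -/
def punion (l r : List ℕ) : List ℕ := (l ++ r).mergeSort (fun a b => decide (a ≥ b))

/-- The ordinary conjugate of a partition: the list of column lengths of its diagram. -/
def conj (l : List ℕ) : List ℕ :=
  (List.range (part l 0)).map (fun j => (l.filter (fun x => decide (j < x))).length)

/-! ### Column lengths of the `k`-skew diagram, computed row by row -/

/-- The position of the first cell of a row of length `a` placed below columns of lengths `c`:
the first column in which the hook-length is at most `k`. -/
noncomputable def rowStart (k a : ℕ) (c : ℕ → ℕ) : ℕ := sInf {j | c j + a ≤ k}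

/-- The column lengths after placing a row of length `a` below columns of lengths `c`. -/
noncomputable def addRow (k a : ℕ) (c : ℕ → ℕ) (j : ℕ) : ℕ :=
  c j + if rowStart k a c ≤ j ∧ j < rowStart k a c + a then 1 else 0

/-- The column lengths of the `k`-skew diagram of `l`. -/
noncomputable def kCols (k : ℕ) : List ℕ → ℕ → ℕ
  | [] => fun _ => 0
  | a :: l => addRow k a (kCols k l)

theorem rowStart_spec {k a : ℕ} {c : ℕ → ℕ} (h : ∃ j, c j + a ≤ k) :
    c (rowStart k a c) + a ≤ k := Nat.sInf_mem (s := {j | c j + a ≤ k}) h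

theorem rowStart_le {k a j : ℕ} {c : ℕ → ℕ} (h : c j + a ≤ k) : rowStart k a c ≤ j :=
  Nat.sInf_le h

theorem lt_of_lt_rowStart {k a j : ℕ} {c : ℕ → ℕ} (h : j < rowStart k a c) : k < c j + a := by
  by_contra! hc
  exact absurd (rowStart_le hc) (by omega)

theorem rowStart_eq {k a p : ℕ} {c : ℕ → ℕ} (hp : c p + a ≤ k) (hlt : ∀ j < p, k < c j + a) :
    rowStart k a c = p := by
  refine le_antisymm (rowStart_le hp) ?_
  by_contra! h
  have := hlt _ h
  have := rowStart_spec ⟨p, hp⟩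
  omega

theorem le_addRow (k a : ℕ) (c : ℕ → ℕ) (j : ℕ) : c j ≤ addRow k a c j := Nat.le_add_right _ _

theorem addRow_le (k a : ℕ) (c : ℕ → ℕ) (j : ℕ) : addRow k a c j ≤ c j + 1 := by
  unfold addRow; split_ifs <;> omega

theorem addRow_antitone {k a : ℕ} {c : ℕ → ℕ} (hc : Antitone c) (h : ∃ j, c j + a ≤ k) :
    Antitone (addRow k a c) := by
  intro i j hij
  have h1 := hc hij
  have h2 := rowStart_spec h
  unfold addRow
  by_cases hj : rowStart k a c ≤ j ∧ j < rowStart k a c + a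
  · by_cases hi : rowStart k a c ≤ i
    · rw [if_pos hj, if_pos ⟨hi, by omega⟩]; omega
    · have := lt_of_lt_rowStart (not_le.1 hi)
      have := hc hj.1
      rw [if_pos hj]; omega
  · rw [if_neg hj]; omega

theorem exists_kCols_eq_zero (k : ℕ) (l : List ℕ) : ∃ N, ∀ j ≥ N, kCols k l j = 0 := by
  induction l with
  | nil => exact ⟨0, fun _ _ => rfl⟩
  | cons a l ih =>
    obtain ⟨N, hN⟩ := ih
    refine ⟨max N (rowStart k a (kCols k l) + a), fun j hj => ?_⟩
    have := hN j (by omega)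
    simp only [kCols, addRow]
    rw [if_neg (by omega), this]

theorem exists_kCols_add_le {k a : ℕ} (l : List ℕ) (ha : a ≤ k) :
    ∃ j, kCols k l j + a ≤ k := by
  obtain ⟨N, hN⟩ := exists_kCols_eq_zero k l
  exact ⟨N, by rw [hN N le_rfl]; omega⟩

theorem kCols_antitone {k : ℕ} {l : List ℕ} (hl : ∀ x ∈ l, x ≤ k) : Antitone (kCols k l) := by
  induction l with
  | nil => exact fun _ _ _ => le_rfl
  | cons a l ih =>
    exact addRow_antitone (ih fun x hx => hl x (List.mem_cons_of_mem _ hx))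
      (exists_kCols_add_le l (hl a List.mem_cons_self))

theorem kCols_le_length (k : ℕ) (l : List ℕ) (j : ℕ) : kCols k l j ≤ l.length := by
  induction l with
  | nil => exact le_rfl
  | cons a l ih =>
    have := addRow_le k a (kCols k l) j
    simp only [kCols, List.length_cons]
    omega

/-! ### Partitions and their parts -/

theorem part_eq_zero {l : List ℕ} {i : ℕ} (h : l.length ≤ i) : part l i = 0 := by
  exact List.getD_eq_default _ _ h

theorem part_eq_getElem {l : List ℕ} {i : ℕ} (h : i < l.length) : part l i = l[i] := by
  simp [part, h]

theorem IsPartition.part_antitone {l : List ℕ} (hl : IsPartition l) : Antitone (part l) := by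
  intro i j hij
  by_cases hj : j < l.length
  · rw [part_eq_getElem hj, part_eq_getElem (hij.trans_lt hj)]
    rcases hij.eq_or_lt with rfl | h
    · exact le_rfl
    · exact List.pairwise_iff_getElem.1 hl.1 i j _ hj h
  · rw [part_eq_zero (not_lt.1 hj)]; exact Nat.zero_le _

theorem IsPartition.part_pos {l : List ℕ} (hl : IsPartition l) {i : ℕ} (hi : i < l.length) :
    0 < part l i := by
  rw [part_eq_getElem hi]; exact hl.2 _ (List.getElem_mem hi)

theorem KBounded.le_of_mem {k : ℕ} {l : List ℕ} (hl : KBounded k l) : ∀ x ∈ l, x ≤ k := by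
  intro x hx
  obtain ⟨i, hi, rfl⟩ := List.getElem_of_mem hx
  rw [← part_eq_getElem hi]
  exact (hl.1.part_antitone (Nat.zero_le i)).trans hl.2

theorem kBounded_of_le {k : ℕ} {l : List ℕ} (hl : IsPartition l) (h : ∀ x ∈ l, x ≤ k) :
    KBounded k l := by
  refine ⟨hl, ?_⟩
  cases l with
  | nil => exact Nat.zero_le _
  | cons a l => exact h a List.mem_cons_self

theorem exists_isPartition_part_eq (N : ℕ) : ∀ f : ℕ → ℕ, Antitone f → (∀ i ≥ N, f i = 0) →
    ∃ l, IsPartition l ∧ ∀ i, part l i = f i := by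
  induction N with
  | zero =>
    intro f _ h0
    exact ⟨[], ⟨List.Pairwise.nil, by simp⟩, fun i => by rw [h0 i (Nat.zero_le _)]; rfl⟩
  | succ N ih =>
    intro f hf h0
    obtain ⟨l, hl, hpart⟩ := ih (fun i => f (i + 1)) (fun i j h => hf (by omega))
      (fun i hi => h0 _ (by omega))
    by_cases hz : f 0 = 0
    · refine ⟨[], ⟨List.Pairwise.nil, by simp⟩, fun i => ?_⟩
      have := hf (Nat.zero_le i)
      simp only [part, List.getD_nil]; omega
    · refine ⟨f 0 :: l, ⟨List.pairwise_cons.2 ⟨fun x hx => ?_, hl.1⟩, fun x hx => ?_⟩, fun i => ?_⟩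
      · obtain ⟨i, hi, rfl⟩ := List.getElem_of_mem hx
        rw [← part_eq_getElem hi, hpart]
        exact hf (Nat.zero_le _)
      · rcases List.mem_cons.1 hx with rfl | hx
        · omega
        · exact hl.2 x hx
      · cases i with
        | zero => rfl
        | succ i => exact hpart i

/-! ### The `k`-conjugate through column lengths -/

/-- The number of cells of column `j` of `outer/inner` in the rows `s, s + 1, …`. -/
def colLenFrom (outer inner : List ℕ) (s j : ℕ) : ℕ :=
  ((Finset.range outer.length).filter
    (fun i => s ≤ i ∧ part inner i ≤ j ∧ j < part outer i)).card

theorem colLen_eq (outer inner : List ℕ) (j : ℕ) :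
    colLen outer inner j = colLenFrom outer inner 0 j := by
  simp [colLen, colLenFrom]

theorem colLenFrom_eq_zero {outer inner : List ℕ} {s j : ℕ} (h : outer.length ≤ s) :
    colLenFrom outer inner s j = 0 := by
  rw [colLenFrom, Finset.card_eq_zero, Finset.filter_eq_empty_iff]
  intro i hi
  have := Finset.mem_range.1 hi
  omega

theorem colLenFrom_eq_add (outer inner : List ℕ) (s j : ℕ) :
    colLenFrom outer inner s j = colLenFrom outer inner (s + 1) j +
      if part inner s ≤ j ∧ j < part outer s then 1 else 0 := by
  unfold colLenFrom
  by_cases h : part inner s ≤ j ∧ j < part outer s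
  · have hs : s < outer.length := by
      by_contra! hs
      rw [part_eq_zero hs] at h
      omega
    rw [if_pos h, ← Finset.card_insert_of_notMem (a := s) (by simp)]
    congr 1
    ext i
    simp only [Finset.mem_insert, Finset.mem_filter, Finset.mem_range]
    constructor
    · rintro ⟨h1, h2, h3⟩
      by_cases hi : i = s
      · exact Or.inl hi
      · exact Or.inr ⟨h1, by omega, h3⟩
    · rintro (rfl | ⟨h1, h2, h3⟩)
      · exact ⟨hs, le_rfl, h⟩
      · exact ⟨h1, by omega, h3⟩
  · rw [if_neg h, add_zero]
    congr 1
    ext i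
    simp only [Finset.mem_filter, Finset.mem_range]
    constructor
    · rintro ⟨h1, h2, h3⟩
      refine ⟨h1, ?_, h3⟩
      rcases h2.eq_or_lt with rfl | h2
      · exact absurd h3 h
      · exact h2
    · rintro ⟨h1, h2, h3⟩
      exact ⟨h1, by omega, h3⟩

theorem hookLen_eq (outer inner : List ℕ) (i j : ℕ) :
    hookLen outer inner i j =
      (part outer i - max j (part inner i)) + colLenFrom outer inner (i + 1) j := by
  unfold hookLen colLenFrom
  congr 1
  rw [← Nat.card_Ico]
  congr 1
  ext x
  simp only [Finset.mem_filter, Finset.mem_range, Finset.mem_Ico]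
  omega

/-- Rows starting at the prescribed positions give the prescribed column lengths. -/
theorem colLenFrom_eq_kCols {k : ℕ} {l outer inner : List ℕ}
    (hrow : ∀ i, part outer i = part inner i + part l i)
    (hstart : ∀ i < l.length, (∀ j, colLenFrom outer inner (i + 1) j = kCols k (l.drop (i + 1)) j) →
      part inner i = rowStart k (part l i) (kCols k (l.drop (i + 1)))) (s j : ℕ) :
    colLenFrom outer inner s j = kCols k (l.drop s) j := by
  obtain ⟨d, hd⟩ : ∃ d, max outer.length l.length ≤ s + d := ⟨_, Nat.le_add_left _ _⟩
  induction d generalizing s j with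
  | zero =>
    rw [colLenFrom_eq_zero (by omega), List.drop_eq_nil_of_le (by omega)]
    rfl
  | succ d ih =>
    have ih' := fun j => ih (s + 1) j (by omega)
    rw [colLenFrom_eq_add, ih', hrow]
    by_cases hs : s < l.length
    · rw [hstart s hs ih', List.drop_eq_getElem_cons hs, ← part_eq_getElem hs]
      rfl
    · rw [part_eq_zero (not_lt.1 hs), if_neg (by omega), List.drop_eq_nil_of_le (by omega),
        List.drop_eq_nil_of_le (by omega), add_zero]

theorem IsKSkew.colLenFrom_eq {k : ℕ} {l outer inner : List ℕ} (hl : KBounded k l)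
    (h : IsKSkew k l outer inner) (s j : ℕ) :
    colLenFrom outer inner s j = kCols k (l.drop s) j := by
  obtain ⟨-, -, hsub, hrow, hcell, hinner⟩ := h
  have hrow' : ∀ i, part outer i = part inner i + part l i := fun i => by
    have := hrow i; have := hsub i; omega
  refine colLenFrom_eq_kCols hrow' (fun i hi hcol => ?_) s j
  have hpos := hl.1.part_pos hi
  refine (rowStart_eq ?_ fun j hj => ?_).symm
  · have := hcell i (part inner i) le_rfl (by rw [hrow']; omega)
    rw [hookLen_eq, hcol, hrow'] at this
    omega
  · have := hinner i j hj
    rw [hookLen_eq, hcol, hrow', max_eq_right hj.le] at this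
    omega

theorem IsKSkew.part_skewCols {k : ℕ} {l outer inner : List ℕ} (hl : KBounded k l)
    (h : IsKSkew k l outer inner) (j : ℕ) : part (skewCols outer inner) j = kCols k l j := by
  have hcol : ∀ j, colLen outer inner j = kCols k l j := fun j => by
    rw [colLen_eq, h.colLenFrom_eq hl, List.drop_zero]
  obtain ⟨hout, -, hsub, hrow, -, hinner⟩ := h
  have hpos : ∀ j < part outer 0, colLen outer inner j ≠ 0 := by
    intro j hj
    rw [colLen_eq, colLenFrom_eq_add]
    by_cases hji : part inner 0 ≤ j
    · rw [if_pos ⟨hji, hj⟩]; omega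
    · have h1 := hinner 0 j (not_le.1 hji)
      rw [hookLen_eq, max_eq_right (by omega)] at h1
      have := hrow 0
      have := hl.2
      simp only [zero_add] at h1 ⊢
      omega
  have hlist : skewCols outer inner = (List.range (part outer 0)).map (colLen outer inner) := by
    rw [skewCols, List.filter_eq_self]
    intro x hx
    obtain ⟨j, hj, rfl⟩ := List.mem_map.1 hx
    simpa using hpos j (List.mem_range.1 hj)
  rw [hlist, ← hcol]
  by_cases hj : j < part outer 0
  · rw [part_eq_getElem (by simpa using hj)]
    simp
  · rw [part_eq_zero (by simpa using hj), eq_comm, colLen, Finset.card_eq_zero,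
      Finset.filter_eq_empty_iff]
    intro i _
    have := hout.part_antitone (Nat.zero_le i)
    omega

theorem KBounded.exists_isKSkew {k : ℕ} {l : List ℕ} (hl : KBounded k l) :
    ∃ p : List ℕ × List ℕ, IsKSkew k l p.1 p.2 := by
  have hle : ∀ i, part l i ≤ k := fun i => (hl.1.part_antitone (Nat.zero_le i)).trans hl.2
  have hanti := hl.1.part_antitone
  set P : ℕ → ℕ := fun i => rowStart k (part l i) (kCols k (l.drop (i + 1))) with hP
  have hPanti : Antitone P := by
    refine antitone_nat_of_succ_le fun i => ?_
    by_contra! hlt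
    have h1 := lt_of_lt_rowStart hlt
    have h2 := rowStart_spec (exists_kCols_add_le (l.drop (i + 1)) (hle i))
    have h3 := hanti (Nat.le_succ i)
    have h4 : kCols k (l.drop (i + 1 + 1)) (P i) ≤ kCols k (l.drop (i + 1)) (P i) := by
      by_cases hi : i + 1 < l.length
      · rw [List.drop_eq_getElem_cons hi]
        exact le_addRow _ _ _ _
      · rw [List.drop_eq_nil_of_le (by omega : l.length ≤ i + 1 + 1)]
        exact Nat.zero_le _
    simp only [hP, Nat.succ_eq_add_one] at h1 h2 h3 h4
    omega
  have hPzero : ∀ i ≥ l.length, P i = 0 := fun i hi => by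
    refine Nat.le_zero.1 (rowStart_le ?_)
    rw [part_eq_zero hi, List.drop_eq_nil_of_le (by omega)]
    exact Nat.zero_le _
  obtain ⟨inner, hinner, hip⟩ := exists_isPartition_part_eq l.length P hPanti hPzero
  obtain ⟨outer, houter, hop⟩ := exists_isPartition_part_eq l.length (fun i => P i + part l i)
    (hPanti.add hanti) (fun i hi => by simp [hPzero i hi, part_eq_zero hi])
  have hcol := colLenFrom_eq_kCols (k := k) (l := l) (outer := outer) (inner := inner)
    (fun i => by rw [hop, hip]) (fun i _ _ => hip i)
  refine ⟨(outer, inner), houter, hinner, fun i => ?_, fun i => ?_, fun i j h1 h2 => ?_,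
    fun i j h => ?_⟩
  · rw [hop, hip]; omega
  · rw [hop, hip]; omega
  · rw [hip] at h1
    have h3 := kCols_antitone (fun x hx => hl.le_of_mem x (List.mem_of_mem_drop hx))
      (l := l.drop (i + 1)) h1
    have h4 := rowStart_spec (exists_kCols_add_le (l.drop (i + 1)) (hle i))
    simp only [hookLen_eq, hcol, hop, hip]
    simp only [hP] at h1 h3 ⊢
    omega
  · rw [hip] at h
    have := lt_of_lt_rowStart h
    simp only [hookLen_eq, hcol, hop, hip]
    rw [max_eq_right h.le]
    omega

theorem KBounded.part_kConj {k : ℕ} {l : List ℕ} (hl : KBounded k l) (j : ℕ) :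
    part (kConj k l) j = kCols k l j := by
  have h := hl.exists_isKSkew
  rw [kConj, dif_pos h]
  exact IsKSkew.part_skewCols hl h.choose_spec j

/-! ### Elements below a rectangle -/

theorem KLe.subDiag {k : ℕ} {l r : List ℕ} (h : KLe k l r) :
    SubDiag l r ∧ SubDiag (kConj k l) (kConj k r) := by
  induction h with
  | refl => exact ⟨fun _ => le_rfl, fun _ => le_rfl⟩
  | tail _ h ih => exact ⟨fun i => (ih.1 i).trans (h.2.2.1 i), fun i => (ih.2 i).trans (h.2.2.2.1 i)⟩

theorem kCols_replicate_le {k m : ℕ} (hmk : m ≤ k) (n j : ℕ) :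
    kCols k (List.replicate n m) j ≤ k - m + 1 := by
  induction n generalizing j with
  | zero => exact Nat.zero_le _
  | succ n ih =>
    rw [List.replicate_succ]
    simp only [kCols, addRow]
    have h1 := rowStart_spec (exists_kCols_add_le (List.replicate n m) hmk)
    have h2 := ih j
    split_ifs with h
    · have := kCols_antitone (k := k) (l := List.replicate n m)
        (fun x hx => (List.eq_of_mem_replicate hx).trans_le hmk) h.1
      omega
    · omega

theorem min_le_kCols_zero {k m : ℕ} (hmk : m ≤ k) {l : List ℕ} (hl : ∀ x ∈ l, 0 < x) :
    min (l.filter (fun x => decide (x < m))).length (k - m + 2) ≤ kCols k l 0 := by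
  induction l with
  | nil => simp
  | cons a l ih =>
    have ih := ih fun x hx => hl x (List.mem_cons_of_mem _ hx)
    have ha := hl a List.mem_cons_self
    have h1 := le_addRow k a (kCols k l) 0
    by_cases ham : a < m
    · rw [List.filter_cons_of_pos (by simpa using ham), List.length_cons]
      by_cases h2 : k - m + 2 ≤ kCols k l 0
      · simp only [kCols]; omega
      · have h3 : rowStart k a (kCols k l) = 0 := Nat.le_zero.1 (rowStart_le (by omega))
        simp only [kCols, addRow, h3]
        rw [if_pos (by omega)]
        omega
    · rw [List.filter_cons_of_neg (by simpa using ham)]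
      simp only [kCols]; omega

theorem subDiag_replicate_iff {l : List ℕ} (hl : IsPartition l) (n m : ℕ) :
    SubDiag l (List.replicate n m) ↔ l.length ≤ n ∧ ∀ x ∈ l, x ≤ m := by
  have hle : ∀ i, part (List.replicate n m) i = if i < n then m else 0 := fun i => by
    split_ifs with h
    · rw [part_eq_getElem (by simpa using h)]; simp
    · exact part_eq_zero (by simpa using h)
  constructor
  · intro h
    refine ⟨?_, fun x hx => ?_⟩
    · by_contra! hn
      have h1 := h n
      have := hl.part_pos hn
      rw [hle, if_neg (lt_irrefl _)] at h1
      omega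
    · obtain ⟨i, hi, rfl⟩ := List.getElem_of_mem hx
      have h1 := h i
      rw [hle, part_eq_getElem hi] at h1
      split_ifs at h1 <;> omega
  · rintro ⟨h1, h2⟩ i
    by_cases hi : i < l.length
    · rw [hle, if_pos (by omega), part_eq_getElem hi]
      exact h2 _ (List.getElem_mem hi)
    · rw [part_eq_zero (not_lt.1 hi)]; exact Nat.zero_le _

/-- Lengthening one column by a cell is preserved by placing a further row. -/
theorem exists_addRow_eq_add_single {k a i : ℕ} {c c' : ℕ → ℕ} (hc : Antitone c)
    (hex : ∃ j, c' j + a ≤ k) (h : ∀ j, c' j = c j + if j = i then 1 else 0) :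
    ∃ i', ∀ j, addRow k a c' j = addRow k a c j + if j = i' then 1 else 0 := by
  have hspec' := rowStart_spec hex
  have hle : rowStart k a c ≤ rowStart k a c' := by
    refine rowStart_le ?_
    have := h (rowStart k a c')
    omega
  have hspec : c (rowStart k a c) + a ≤ k := by
    refine rowStart_spec (hex.imp fun j hj => ?_)
    have := h j
    omega
  rcases hle.eq_or_lt with heq | hlt
  · refine ⟨i, fun j => ?_⟩
    simp only [addRow, ← heq, h]
    omega
  · have h1 := lt_of_lt_rowStart hlt
    have hpi : rowStart k a c = i := by
      by_contra hne
      rw [h, if_neg hne] at h1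
      omega
    have h2 : rowStart k a c' = rowStart k a c + 1 := by
      refine le_antisymm (rowStart_le ?_) hlt
      have h3 := hc (Nat.le_succ (rowStart k a c))
      rw [h, if_neg (by omega)]
      simp only [Nat.succ_eq_add_one] at h3
      omega
    refine ⟨i + a, fun j => ?_⟩
    simp only [addRow, h2, h, hpi]
    split_ifs <;> omega

theorem exists_kCols_replicate_append_eq_add_single {k m i : ℕ} (hmk : m ≤ k) {l l' : List ℕ}
    (hl : ∀ x ∈ l, x ≤ k) (h : ∀ j, kCols k l' j = kCols k l j + if j = i then 1 else 0)
    (a : ℕ) :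
    ∃ i', ∀ j, kCols k (List.replicate a m ++ l') j =
      kCols k (List.replicate a m ++ l) j + if j = i' then 1 else 0 := by
  induction a with
  | zero => exact ⟨i, h⟩
  | succ a ih =>
    obtain ⟨i', hi'⟩ := ih
    refine exists_addRow_eq_add_single (kCols_antitone fun x hx => ?_)
      (exists_kCols_add_le _ hmk) hi'
    rcases List.mem_append.1 hx with hx | hx
    · exact (List.eq_of_mem_replicate hx).trans_le hmk
    · exact hl x hx

theorem kCols_cons_of_length_le {k b : ℕ} {l : List ℕ} (h : l.length + b ≤ k) (j : ℕ) :
    kCols k (b :: l) j = kCols k l j + if j < b then 1 else 0 := by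
  have h0 := kCols_le_length k l 0
  have : rowStart k b (kCols k l) = 0 := Nat.le_zero.1 (rowStart_le (by omega))
  simp [kCols, addRow, this]

theorem isPartition_replicate_append {m : ℕ} (hm : 1 ≤ m) {l : List ℕ} (hl : IsPartition l)
    (hlm : ∀ x ∈ l, x ≤ m) (a : ℕ) : IsPartition (List.replicate a m ++ l) := by
  refine ⟨List.pairwise_append.2 ⟨List.pairwise_replicate.2 (Or.inr le_rfl), hl.1,
    fun x hx y hy => ?_⟩, fun x hx => ?_⟩
  · rw [List.eq_of_mem_replicate hx]; exact hlm y hy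
  · rcases List.mem_append.1 hx with hx | hx
    · rw [List.eq_of_mem_replicate hx]; exact hm
    · exact hl.2 x hx

theorem kCover_replicate_append {k m i : ℕ} (hm : 1 ≤ m) (hmk : m ≤ k) {l l' : List ℕ}
    (hl : IsPartition l) (hl' : IsPartition l') (hlm : ∀ x ∈ l, x ≤ m) (hlm' : ∀ x ∈ l', x ≤ m)
    (hsub : SubDiag l l') (hsum : l'.sum = l.sum + 1)
    (h : ∀ j, kCols k l' j = kCols k l j + if j = i then 1 else 0) (a : ℕ) :
    KCover k (List.replicate a m ++ l) (List.replicate a m ++ l') := by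
  have key : ∀ r : List ℕ, IsPartition r → (∀ x ∈ r, x ≤ m) →
      KBounded k (List.replicate a m ++ r) := fun r hr hrm =>
    kBounded_of_le (isPartition_replicate_append hm hr hrm a) fun x hx => by
      rcases List.mem_append.1 hx with hx | hx
      · exact (List.eq_of_mem_replicate hx).trans_le hmk
      · exact (hrm x hx).trans hmk
  refine ⟨key l hl hlm, key l' hl' hlm', fun j => ?_, fun j => ?_, ?_⟩
  · simp only [part]
    by_cases hj : j < a
    · rw [List.getD_append _ _ _ _ (by simpa using hj), List.getD_append _ _ _ _ (by simpa using hj)]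
    · rw [List.getD_append_right _ _ _ _ (by simpa using hj),
        List.getD_append_right _ _ _ _ (by simpa using hj)]
      exact hsub _
  · obtain ⟨i', hi'⟩ := exists_kCols_replicate_append_eq_add_single hmk
      (fun x hx => (hlm x hx).trans hmk) h a
    rw [(key l hl hlm).part_kConj, (key l' hl' hlm').part_kConj, hi']
    exact Nat.le_add_right _ _
  · rw [List.sum_append, List.sum_append, hsum, add_assoc]

/-- The first row below the rows of length `m` can be completed to length `m`. -/
theorem kLe_replicate_append_cons {k m : ℕ} (hm : 1 ≤ m) (hmk : m ≤ k) (a : ℕ) {r : List ℕ}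
    (hr : r.length ≤ k - m) (d : ℕ) : ∀ b, b + d = m → IsPartition (b :: r) →
    KLe k (List.replicate a m ++ b :: r) (List.replicate (a + 1) m ++ r) := by
  induction d with
  | zero =>
    rintro b rfl -
    rw [List.replicate_succ', List.append_assoc]
    exact Relation.ReflTransGen.refl
  | succ d ih =>
    intro b hb hpart
    obtain ⟨hbr, hrr⟩ := List.pairwise_cons.1 hpart.1
    have hpart' : IsPartition ((b + 1) :: r) :=
      ⟨List.pairwise_cons.2 ⟨fun x hx => (hbr x hx).trans (Nat.le_succ b), hrr⟩, fun x hx => by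
        rcases List.mem_cons.1 hx with rfl | hx
        · omega
        · exact hpart.2 x (List.mem_cons_of_mem _ hx)⟩
    refine Relation.ReflTransGen.head (kCover_replicate_append (i := b) hm hmk hpart hpart'
      (fun x hx => ?_) (fun x hx => ?_) (fun i => ?_) ?_ (fun j => ?_) a)
      (ih (b + 1) (by omega) hpart')
    · rcases List.mem_cons.1 hx with rfl | hx
      · omega
      · have := hbr x hx; omega
    · rcases List.mem_cons.1 hx with rfl | hx
      · omega
      · have := hbr x hx; omega
    · cases i with
      | zero => exact Nat.le_succ b
      | succ i => exact le_rfl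
    · simp only [List.sum_cons]; omega
    · rw [kCols_cons_of_length_le (by omega), kCols_cons_of_length_le (by omega)]
      split_ifs <;> omega

theorem kLe_replicate_append_replicate {k m : ℕ} (hm : 1 ≤ m) (hmk : m ≤ k) (d : ℕ) :
    ∀ a (l : List ℕ), IsPartition l → (∀ x ∈ l, x ≤ m) → l.length ≤ k - m + 1 → l.length ≤ d →
      KLe k (List.replicate a m ++ l) (List.replicate (a + d) m) := by
  induction d with
  | zero =>
    intro a l _ _ _ hd
    rw [List.eq_nil_of_length_eq_zero (Nat.le_zero.1 hd), List.append_nil]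
    exact Relation.ReflTransGen.refl
  | succ d ih =>
    intro a l hl hlm hlen hd
    have hnil : IsPartition [] := ⟨List.Pairwise.nil, by simp⟩
    rw [show a + (d + 1) = a + 1 + d by omega]
    cases l with
    | nil =>
      have hone : IsPartition [1] := ⟨List.pairwise_singleton _ _, by simp⟩
      refine Relation.ReflTransGen.head (kCover_replicate_append (i := 0) hm hmk hnil hone (by simp)
        (by simpa using hm) (fun i => ?_) rfl (fun j => ?_) a) ?_
      · simp [part]
      · rw [kCols_cons_of_length_le (by simp; omega)]
        simp
      · exact (kLe_replicate_append_cons hm hmk a (Nat.zero_le _) (m - 1) 1 (by omega) hone).trans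
          (ih (a + 1) [] hnil (by simp) (Nat.zero_le _) (Nat.zero_le _))
    | cons b r =>
      simp only [List.length_cons] at hlen hd
      have hb := hlm b List.mem_cons_self
      exact (kLe_replicate_append_cons hm hmk a (by omega) (m - b) b (by omega) hl).trans
        (ih (a + 1) r ⟨(List.pairwise_cons.1 hl.1).2, fun x hx => hl.2 x (List.mem_cons_of_mem _ hx)⟩
          (fun x hx => hlm x (List.mem_cons_of_mem _ hx)) (by omega) (by omega))

theorem exists_eq_replicate_append {m : ℕ} {l : List ℕ} (hl : IsPartition l)
    (hlm : ∀ x ∈ l, x ≤ m) :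
    ∃ a r, l = List.replicate a m ++ r ∧ IsPartition r ∧ ∀ x ∈ r, x < m := by
  induction l with
  | nil => exact ⟨0, [], rfl, hl, by simp⟩
  | cons b l ih =>
    obtain ⟨hbl, hll⟩ := List.pairwise_cons.1 hl.1
    rcases (hlm b List.mem_cons_self).eq_or_lt with rfl | hb
    · obtain ⟨a, r, rfl, hr⟩ := ih ⟨hll, fun x hx => hl.2 x (List.mem_cons_of_mem _ hx)⟩
        fun x hx => hlm x (List.mem_cons_of_mem _ hx)
      exact ⟨a + 1, r, rfl, hr⟩
    · refine ⟨0, b :: l, rfl, hl, fun x hx => ?_⟩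
      rcases List.mem_cons.1 hx with rfl | hx
      · exact hb
      · exact (hbl x hx).trans_lt hb

/-- `μ ≼ (m^n)` in the `k`-Young order iff `μ ⊆ (m^n)` and `μ` has at
most `k - m + 1` parts strictly smaller than `m`. -/
theorem kLe_rectangle_iff (k m n : ℕ) (hm : 1 ≤ m) (hmk : m ≤ k) (μ : List ℕ)
    (hμ : IsPartition μ) :
    KLe k μ (List.replicate n m) ↔
      SubDiag μ (List.replicate n m) ∧
        (μ.filter (fun x => decide (x < m))).length ≤ k - m + 1 := by
  constructor
  · intro h
    obtain ⟨hsub, hconj⟩ := h.subDiag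
    refine ⟨hsub, ?_⟩
    have hμm := ((subDiag_replicate_iff hμ n m).1 hsub).2
    have hμk := kBounded_of_le hμ fun x hx => (hμm x hx).trans hmk
    have hrect : KBounded k (List.replicate n m) :=
      kBounded_of_le ⟨List.pairwise_replicate.2 (Or.inr le_rfl),
        fun x hx => (List.eq_of_mem_replicate hx).symm ▸ hm⟩
        fun x hx => (List.eq_of_mem_replicate hx).trans_le hmk
    have h1 := hconj 0
    rw [hμk.part_kConj, hrect.part_kConj] at h1
    have h2 := kCols_replicate_le hmk n 0
    have h3 := min_le_kCols_zero hmk hμ.2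
    omega
  · rintro ⟨hsub, hcount⟩
    obtain ⟨hlen, hle⟩ := (subDiag_replicate_iff hμ n m).1 hsub
    obtain ⟨a, r, rfl, hr, hrm⟩ := exists_eq_replicate_append hμ hle
    have hfilter : r.filter (fun x => decide (x < m)) = r :=
      List.filter_eq_self.2 fun x hx => decide_eq_true (hrm x hx)
    rw [List.filter_append, hfilter, List.length_append] at hcount
    rw [List.length_append, List.length_replicate] at hlen
    obtain ⟨d, rfl⟩ : ∃ d, n = a + d := ⟨n - a, by omega⟩
    exact kLe_replicate_append_replicate hm hmk d a r hr (fun x hx => (hrm x hx).le)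
      (by omega) (by omega)
end

section
/- Let 2 ≤ m < k and n ≥ k−m+1. Then the following identity holds in ℤ[q]: the sum of q^{|λ|} over all partitions λ contained in the rectangle (m^n) having exactly k−m+1 parts strictly smaller than m equals q^{k−m+1} · (∑_{i=0}^{n−k+m−1} q^{mi}) · G(k−m+1, m−2), where G(a,b) = ∑_{μ ⊆ (b^a)} q^{|μ|} is the generating function of partitions with at most a parts, each part at most b (the Gaussian binomial coefficient [a+b choose b]_q). Equivalently, the rank-generating function of Γ^k(m,n) equals q^{k−m+1}·(1−q^{m(n−k+m)})/(1−q^m)·[k−1 choose m−2]_q. -/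
open Polynomial in
/-- The Gaussian binomial coefficient `[a+b choose b]_q`: the generating function by
size of partitions with at most `a` parts, each part at most `b`. -/
noncomputable def Gq (a b : ℕ) : Polynomial ℤ :=
  ∑ i ∈ Finset.range (a * b + 1),
    (({l : List ℕ | IsPartition l ∧ l.length ≤ a ∧ (∀ x ∈ l, x ≤ b) ∧
        l.sum = i}.ncard : Polynomial ℤ)) * X ^ i

/-- Lists of bounded length with bounded entries form a finite set. -/
theorem finite_lists_bounded (a b : ℕ) :
    {l : List ℕ | l.length ≤ a ∧ ∀ x ∈ l, x ≤ b}.Finite := by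
  refine ((List.finite_length_le (Fin (b + 1)) a).image (List.map Fin.val)).subset ?_
  rintro l ⟨hl, hb⟩
  refine ⟨l.map (Fin.ofNat (b + 1)), by simpa using hl, ?_⟩
  rw [List.map_map]
  conv_rhs => rw [← List.map_id l]
  refine List.map_congr_left fun x hx => ?_
  simpa using Nat.mod_eq_of_lt (Nat.lt_succ_of_le (hb x hx))

/-- The size of a list is at most its maximal length times its maximal entry. -/
theorem sum_le_of_bounded {l : List ℕ} {a b : ℕ} (hl : l.length ≤ a) (hb : ∀ x ∈ l, x ≤ b) :
    l.sum ≤ a * b :=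
  (List.sum_le_card_nsmul l b hb).trans (Nat.mul_le_mul_right b hl)

open Polynomial in
/-- Grouping the members of a finite set of lists by size. -/
theorem sum_ncard_mul_X_pow {S : Set (List ℕ)} (hS : S.Finite) {N : ℕ}
    (hN : ∀ l ∈ S, l.sum ≤ N) :
    (∑ i ∈ Finset.range (N + 1), ({l | l ∈ S ∧ l.sum = i}.ncard : Polynomial ℤ) * X ^ i) =
      ∑ l ∈ hS.toFinset, X ^ l.sum := by
  have hmaps : ∀ l ∈ hS.toFinset, l.sum ∈ Finset.range (N + 1) := fun l hl =>
    Finset.mem_range.2 (Nat.lt_succ_of_le (hN l (hS.mem_toFinset.1 hl)))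
  rw [← Finset.sum_fiberwise_of_maps_to hmaps]
  refine Finset.sum_congr rfl fun i _ => ?_
  have hset : {l | l ∈ S ∧ l.sum = i} = ↑(hS.toFinset.filter fun l => l.sum = i) := by
    ext l; simp
  rw [hset, Set.ncard_coe_finset, Finset.sum_congr rfl fun l hl => by
    rw [(Finset.mem_filter.1 hl).2], Finset.sum_const, nsmul_eq_mul]

/-- A weakly decreasing list splits off the entries equal to an upper bound. -/
theorem eq_replicate_append_filter_lt {l : List ℕ} {m : ℕ} (hl : l.Pairwise (· ≥ ·))
    (hm : ∀ x ∈ l, x ≤ m) :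
    l = List.replicate (l.count m) m ++ l.filter (fun x => decide (x < m)) := by
  induction l with
  | nil => simp
  | cons a l ih =>
    rw [List.pairwise_cons] at hl
    have ha := hm a (by simp)
    have ih := ih hl.2 fun x hx => hm x (by simp [hx])
    rcases ha.eq_or_lt with rfl | ha
    · simpa [List.replicate_succ] using ih
    · have hlt : ∀ x ∈ a :: l, x < m := by
        intro x hx
        rcases List.mem_cons.1 hx with rfl | hx
        · exact ha
        · exact (hl.1 x hx).trans_lt ha
      have hc : (a :: l).count m = 0 := List.count_eq_zero.2 fun h => (hlt m h).false
      rw [hc, List.filter_eq_self.2 (by simpa using hlt)]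
      simp

/-- Lowering all entries of a weakly decreasing list of positive integers by one, discarding
zeros, is undone by raising the entries and padding with ones. -/
theorem map_succ_filter_pred_append {l : List ℕ} (hl : IsPartition l) :
    (((l.map Nat.pred).filter (fun x => decide (0 < x))).map Nat.succ ++
      List.replicate (l.length - ((l.map Nat.pred).filter (fun x => decide (0 < x))).length) 1) =
      l := by
  obtain ⟨hs, hp⟩ := hl
  induction l with
  | nil => simp
  | cons a l ih =>
    rw [List.pairwise_cons] at hs
    have ha := hp a (by simp)
    have ih := ih hs.2 fun x hx => hp x (by simp [hx])
    rcases Nat.eq_or_lt_of_le (Nat.succ_le_of_lt ha) with ha1 | ha1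
    · have hone : ∀ x ∈ a :: l, x = 1 := by
        intro x hx
        have h0 := hp x hx
        rcases List.mem_cons.1 hx with rfl | hx
        · omega
        · have := hs.1 x hx
          omega
      rw [List.eq_replicate_of_mem hone]
      simp
    · have : 0 < a.pred := by simp; omega
      rw [List.map_cons, List.filter_cons_of_pos (by simpa using this)]
      simp only [List.map_cons, List.length_cons, List.cons_append, Nat.add_sub_add_right]
      rw [ih, Nat.succ_pred_eq_of_pos ha]

/-- The partition with `t` parts equal to `m` followed by `a` smaller parts, obtained from `μ`
by padding it with zeros to length `a` and raising every entry by one. -/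
def gammaOf (m a : ℕ) (p : ℕ × List ℕ) : List ℕ :=
  List.replicate p.1 m ++ (p.2.map Nat.succ ++ List.replicate (a - p.2.length) 1)

/-- The number of parts equal to `m`, and the remaining parts lowered by one. -/
def gammaInv (m : ℕ) (l : List ℕ) : ℕ × List ℕ :=
  (l.count m, ((l.filter (fun x => decide (x < m))).map Nat.pred).filter (fun x => decide (0 < x)))

theorem sum_gammaOf {m a t : ℕ} {μ : List ℕ} (hμ : μ.length ≤ a) :
    (gammaOf m a (t, μ)).sum = a + m * t + μ.sum := by
  have h : (μ.map Nat.succ).sum = μ.sum + μ.length := by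
    clear hμ
    induction μ with
    | nil => rfl
    | cons x μ ih => simp only [List.map_cons, List.sum_cons, List.length_cons, ih]; omega
  simp only [gammaOf, List.sum_append, List.sum_replicate, smul_eq_mul, h, mul_one]
  rw [mul_comm t m]
  omega

theorem filter_lt_gammaOf {m a t : ℕ} {μ : List ℕ} (hm : 2 ≤ m) (hb : ∀ x ∈ μ, x ≤ m - 2) :
    (gammaOf m a (t, μ)).filter (fun x => decide (x < m)) =
      μ.map Nat.succ ++ List.replicate (a - μ.length) 1 := by
  rw [gammaOf, List.filter_append, List.filter_eq_nil_iff.2 (by simp), List.nil_append,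
    List.filter_eq_self]
  intro x hx
  simp only [List.mem_append, List.mem_map, List.mem_replicate] at hx
  rcases hx with ⟨y, hy, rfl⟩ | ⟨_, rfl⟩
  · have := hb y hy
    simp; omega
  · simp; omega

theorem isPartition_gammaOf {m a t : ℕ} {μ : List ℕ} (hm : 2 ≤ m) (hμ : IsPartition μ)
    (hb : ∀ x ∈ μ, x ≤ m - 2) : IsPartition (gammaOf m a (t, μ)) := by
  refine ⟨?_, ?_⟩
  · simp only [gammaOf, List.pairwise_append, List.pairwise_map, List.pairwise_replicate,
      List.mem_append, List.mem_map, List.mem_replicate]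
    refine ⟨by simp, ⟨hμ.1.imp fun h => Nat.succ_le_succ h, by simp, ?_⟩, ?_⟩
    · rintro _ ⟨y, _, rfl⟩ _ ⟨_, rfl⟩
      simp
    · rintro _ ⟨_, rfl⟩ _ (⟨y, hy, rfl⟩ | ⟨_, rfl⟩)
      · have := hb y hy
        simp; omega
      · omega
  · intro x hx
    simp only [gammaOf, List.mem_append, List.mem_map, List.mem_replicate] at hx
    rcases hx with ⟨_, rfl⟩ | ⟨y, _, rfl⟩ | ⟨_, rfl⟩ <;> omega

theorem gammaInv_gammaOf {m a t : ℕ} {μ : List ℕ} (hm : 2 ≤ m) (hμ : IsPartition μ)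
    (hb : ∀ x ∈ μ, x ≤ m - 2) : gammaInv m (gammaOf m a (t, μ)) = (t, μ) := by
  rw [gammaInv, filter_lt_gammaOf hm hb]
  refine Prod.ext ?_ ?_
  · have h1 : (μ.map Nat.succ).count m = 0 := by
      rw [List.count_eq_zero, List.mem_map]
      rintro ⟨y, hy, h⟩
      have := hb y hy
      omega
    simp only [gammaOf, List.count_append, List.count_replicate_self, h1, List.count_replicate]
    simp; omega
  · have h2 : (μ.map Nat.succ).map Nat.pred = μ := by simp [Function.comp_def]
    simp only [List.map_append, h2, List.filter_append]
    rw [List.filter_eq_self.2 (by simpa using hμ.2)]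
    simp

theorem gammaOf_gammaInv {m a : ℕ} {l : List ℕ} (hl : IsPartition l) (hb : ∀ x ∈ l, x ≤ m)
    (ha : (l.filter (fun x => decide (x < m))).length = a) :
    gammaOf m a (gammaInv m l) = l := by
  have hsmall : IsPartition (l.filter (fun x => decide (x < m))) :=
    ⟨hl.1.filter _, fun x hx => hl.2 x (List.mem_of_mem_filter hx)⟩
  subst ha
  simp only [gammaOf, gammaInv]
  rw [map_succ_filter_pred_append hsmall, ← eq_replicate_append_filter_lt hl.1 hb]

open Polynomial in
/-- the rank-generating function of `Γ^k(m,n)` equals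
`q^{k-m+1}·(1-q^{m(n-k+m)})/(1-q^m)·[k-1 choose m-2]_q`. -/
theorem gamma_rank_gen_fun (k m n : ℕ) (hm : 2 ≤ m) (hmk : m < k)
    (hn : k - m + 1 ≤ n) :
    (∑ i ∈ Finset.range (m * n + 1),
      (({l : List ℕ | IsPartition l ∧ SubDiag l (List.replicate n m) ∧
          (l.filter (fun x => decide (x < m))).length = k - m + 1 ∧
          l.sum = i}.ncard : Polynomial ℤ)) * X ^ i)
    = X ^ (k - m + 1) * (∑ t ∈ Finset.range (n - (k - m + 1) + 1), X ^ (m * t)) *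
        Gq (k - m + 1) (m - 2) := by
  set a := k - m + 1
  have hS : {l : List ℕ | IsPartition l ∧ (l.length ≤ n ∧ ∀ x ∈ l, x ≤ m) ∧
      (l.filter (fun x => decide (x < m))).length = a}.Finite :=
    (finite_lists_bounded n m).subset fun l hl => hl.2.1
  have hT : {l : List ℕ | IsPartition l ∧ l.length ≤ a ∧ ∀ x ∈ l, x ≤ m - 2}.Finite :=
    (finite_lists_bounded a (m - 2)).subset fun l hl => hl.2
  have hL := sum_ncard_mul_X_pow hS (N := m * n) fun l hl =>
    (sum_le_of_bounded hl.2.1.1 hl.2.1.2).trans_eq (mul_comm n m)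
  have hR := sum_ncard_mul_X_pow hT fun l hl => sum_le_of_bounded hl.2.1 hl.2.2
  have hset (i : ℕ) : {l : List ℕ | IsPartition l ∧ SubDiag l (List.replicate n m) ∧
      (l.filter (fun x => decide (x < m))).length = a ∧ l.sum = i} =
      {l | l ∈ {l : List ℕ | IsPartition l ∧ (l.length ≤ n ∧ ∀ x ∈ l, x ≤ m) ∧
        (l.filter (fun x => decide (x < m))).length = a} ∧ l.sum = i} := by
    ext l
    simp only [Set.mem_ofPred_eq, and_assoc]
    refine and_congr_right fun hl => ?_
    rw [subDiag_replicate_iff hl, and_assoc]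
  simp only [Set.mem_ofPred_eq, and_assoc] at hR
  simp only [hset, hL, Gq, hR]
  rw [mul_assoc, Finset.sum_mul_sum, ← Finset.sum_product', Finset.mul_sum]
  symm
  refine Finset.sum_bij' (fun p _ => gammaOf m a p) (fun l _ => gammaInv m l) ?_ ?_ ?_ ?_ ?_
  · rintro ⟨t, μ⟩ h
    simp only [Finset.mem_product, Finset.mem_range, Set.Finite.mem_toFinset,
      Set.mem_ofPred_eq] at h ⊢
    obtain ⟨ht, hμ, hlen, hb⟩ := h
    refine ⟨isPartition_gammaOf hm hμ hb, ⟨?_, fun x hx => ?_⟩, ?_⟩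
    · simp [gammaOf]; omega
    · simp only [gammaOf, List.mem_append, List.mem_map, List.mem_replicate] at hx
      rcases hx with ⟨_, rfl⟩ | ⟨y, hy, rfl⟩ | ⟨_, rfl⟩
      · exact le_rfl
      · have := hb y hy
        omega
      · omega
    · rw [filter_lt_gammaOf hm hb]
      simp; omega
  · intro l h
    simp only [Finset.mem_product, Finset.mem_range, Set.Finite.mem_toFinset,
      Set.mem_ofPred_eq] at h ⊢
    obtain ⟨hl, ⟨hlen, hb⟩, ha⟩ := h
    have hcount := congrArg List.length (eq_replicate_append_filter_lt hl.1 hb)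
    rw [List.length_append, List.length_replicate, ha] at hcount
    refine ⟨by simp only [gammaInv]; omega, ⟨?_, ?_⟩, ?_, ?_⟩
    · refine List.Pairwise.filter _ (List.pairwise_map.2 ?_)
      exact (hl.1.filter _).imp fun h => Nat.pred_le_pred h
    · simp [gammaInv]
    · rw [← ha]
      exact (List.length_filter_le _ _).trans_eq (List.length_map _)
    · intro x hx
      obtain ⟨y, hy, rfl⟩ := List.mem_map.1 (List.mem_of_mem_filter hx)
      have := (List.mem_filter.1 hy).2
      simp only [decide_eq_true_eq] at this
      simp; omega
  · rintro ⟨t, μ⟩ h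
    simp only [Finset.mem_product, Set.Finite.mem_toFinset, Set.mem_ofPred_eq] at h
    exact gammaInv_gammaOf hm h.2.1 h.2.2.2
  · intro l h
    simp only [Set.Finite.mem_toFinset, Set.mem_ofPred_eq] at h
    exact gammaOf_gammaInv h.1 h.2.1.2 h.2.2
  · rintro ⟨t, μ⟩ h
    simp only [Finset.mem_product, Set.Finite.mem_toFinset, Set.mem_ofPred_eq] at h
    rw [sum_gammaOf h.2.2.1, ← pow_add, ← pow_add, add_assoc a]
end
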